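/- arXiv:2501.03774 — 10 statements merged into one kernel-verified Lean document; each statement's English description precedes it below -/
import Mathlib

section
/- Suppose y² = f(x) and x ≠ 0. Then the point (X, Y) = (k₁²(x−1)(x−α²)/x, k₁³y/x²) satisfies Y² = X(X−1)(X − k₁²(1 − 1/γ²)(γ² − α²)); that is, the map φ₁(x,y) = (k₁²(x−1)(x−α²)/x, k₁³y/x²) sends every point of V with x ≠ 0 to a point of the elliptic curve E. -/
open Complex

theorem phi1_maps_V_to_E
    (α β γ k₁ x y : ℂ)
    (hβγ : β * γ ≠ 0)
    (hβα : (1 - β^2) * (β^2 - α^2) ≠ 0)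
    (hk₁ : k₁^2 = -β^2 / ((1 - β^2) * (β^2 - α^2)))
    (hV : y^2 = x * (x - 1) * (x - α^2) * (x - β^2) * (x - γ^2) *
        (x - α^2 / β^2) * (x - α^2 / γ^2))
    (hx : x ≠ 0) :
    (k₁^3 * y / x^2)^2 =
      (k₁^2 * (x - 1) * (x - α^2) / x) *
      (k₁^2 * (x - 1) * (x - α^2) / x - 1) *
      (k₁^2 * (x - 1) * (x - α^2) / x - k₁^2 * (1 - 1 / γ^2) * (γ^2 - α^2)) := by
  obtain ⟨hβ, hγ⟩ := mul_ne_zero_iff.mp hβγ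
  have factor : ∀ c : ℂ, c ≠ 0 →
      (x - 1) * (x - α^2) / x - (1 - 1 / c^2) * (c^2 - α^2) =
        (x - c^2) * (x - α^2 / c^2) / x := by
    intro c hc
    field_simp
    ring
  have hone : k₁^2 * ((1 - 1 / β^2) * (β^2 - α^2)) = 1 := by
    obtain ⟨h₁, h₂⟩ := mul_ne_zero_iff.mp hβα
    rw [hk₁]
    field_simp
    ring
  have hX : k₁^2 * (x - 1) * (x - α^2) / x - 1 =
      k₁^2 * ((x - β^2) * (x - α^2 / β^2) / x) := by
    linear_combination k₁^2 * factor β hβ + hone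
  have hX' : k₁^2 * (x - 1) * (x - α^2) / x - k₁^2 * (1 - 1 / γ^2) * (γ^2 - α^2) =
      k₁^2 * ((x - γ^2) * (x - α^2 / γ^2) / x) := by
    linear_combination k₁^2 * factor γ hγ
  rw [hX, hX', div_pow, mul_pow, hV]
  generalize α^2 / β^2 = u
  generalize α^2 / γ^2 = v
  field_simp
end

section
/- Suppose y² = f(x) and x ≠ α. Then the point (X, Y) = (((x+α)/(x−α))², 4αk₂(x+α)y/(x−α)⁵) satisfies Y² = X(X−1)(X−a²)(X−b²)(X−c²); that is, the map φ₂(x,y) = (((x+α)/(x−α))², 4αk₂(x+α)y/(x−α)⁵) sends every point of V with x ≠ α to a point of the genus-2 curve C. -/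
open Complex

theorem cayley_sq_sub_cayley_sq {K : Type*} [Field K] {α t x : K}
    (ht : t ≠ 0) (htα : t - α ≠ 0) (hxα : x - α ≠ 0) :
    ((x + α) / (x - α))^2 - ((t + α) / (t - α))^2 =
      -4 * α * t * ((x - t) * (x - α^2 / t)) / ((x - α)^2 * (t - α)^2) := by
  field_simp
  ring

theorem phi2_maps_V_to_C
    (α β γ k₂ x y : ℂ)
    (hβγ : β * γ ≠ 0)
    (hden : (1 - α) * (β^2 - α) * (γ^2 - α) ≠ 0)
    (hk₂ : k₂^2 = -16 * α^2 * β^2 * γ^2 / ((1 - α)^2 * (β^2 - α)^2 * (γ^2 - α)^2))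
    (hV : y^2 = x * (x - 1) * (x - α^2) * (x - β^2) * (x - γ^2) *
        (x - α^2 / β^2) * (x - α^2 / γ^2))
    (hx : x ≠ α) :
    (4 * α * k₂ * (x + α) * y / (x - α)^5)^2 =
      (((x + α) / (x - α))^2) *
      (((x + α) / (x - α))^2 - 1) *
      (((x + α) / (x - α))^2 - ((1 + α) / (1 - α))^2) *
      (((x + α) / (x - α))^2 - ((β^2 + α) / (β^2 - α))^2) *
      (((x + α) / (x - α))^2 - ((γ^2 + α) / (γ^2 - α))^2) := by
  obtain ⟨hβ, hγ⟩ := mul_ne_zero_iff.mp hβγ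
  obtain ⟨h, hγα⟩ := mul_ne_zero_iff.mp hden
  obtain ⟨h1α, hβα⟩ := mul_ne_zero_iff.mp h
  have hxα : x - α ≠ 0 := sub_ne_zero.mpr hx
  have hX : ((x + α) / (x - α))^2 - 1 = 4 * α * x / (x - α)^2 := by
    field_simp
    ring
  rw [hX, cayley_sq_sub_cayley_sq one_ne_zero h1α hxα,
    cayley_sq_sub_cayley_sq (pow_ne_zero 2 hβ) hβα hxα,
    cayley_sq_sub_cayley_sq (pow_ne_zero 2 hγ) hγα hxα, div_one,
    div_pow, mul_pow, mul_pow, mul_pow, hk₂, hV]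
  generalize x - α^2 / β^2 = u
  generalize x - α^2 / γ^2 = v
  field_simp
  ring
end

section
/- Let a, b, c ∈ ℂ with a ≠ ±1, b ≠ ±1, c ≠ ±1, and let α, β, γ, d ∈ ℂ satisfy α = (a−1)/(a+1), β² = (a−1)(b+1)/((a+1)(b−1)), γ² = (a−1)(c+1)/((a+1)(c−1)), d² = (1−b²)(c²−1), and d ≠ 0. Suppose t² = F(s) and s ≠ 1. Then the point (x, y) = ((a−1)(s+1)/((a+1)(s−1)), 8(a−1)³t/((a+1)⁴ d (s−1)⁴)) satisfies y² = f(x); that is, the map ζ sends every point of H with s ≠ 1 to a point of V. -/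
open Complex

theorem zeta_maps_H_to_V
    (a b c α β γ d s t : ℂ)
    (ha1 : a ≠ 1) (ha2 : a ≠ -1)
    (hb1 : b ≠ 1) (hb2 : b ≠ -1)
    (hc1 : c ≠ 1) (hc2 : c ≠ -1)
    (hα : α = (a - 1) / (a + 1))
    (hβ : β^2 = (a - 1) * (b + 1) / ((a + 1) * (b - 1)))
    (hγ : γ^2 = (a - 1) * (c + 1) / ((a + 1) * (c - 1)))
    (hd : d^2 = (1 - b^2) * (c^2 - 1))
    (hd0 : d ≠ 0)
    (hH : t^2 = (s^2 - 1) * (s^2 - a^2) * (s^2 - b^2) * (s^2 - c^2))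
    (hs : s ≠ 1) :
    (8 * (a - 1)^3 * t / ((a + 1)^4 * d * (s - 1)^4))^2 =
      ((a - 1) * (s + 1) / ((a + 1) * (s - 1))) *
      ((a - 1) * (s + 1) / ((a + 1) * (s - 1)) - 1) *
      ((a - 1) * (s + 1) / ((a + 1) * (s - 1)) - α^2) *
      ((a - 1) * (s + 1) / ((a + 1) * (s - 1)) - β^2) *
      ((a - 1) * (s + 1) / ((a + 1) * (s - 1)) - γ^2) *
      ((a - 1) * (s + 1) / ((a + 1) * (s - 1)) - α^2 / β^2) *
      ((a - 1) * (s + 1) / ((a + 1) * (s - 1)) - α^2 / γ^2) := by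
  have ha : a - 1 ≠ 0 := sub_ne_zero.2 ha1
  have ha' : a + 1 ≠ 0 := fun h => ha2 (eq_neg_of_add_eq_zero_left h)
  have hb : b - 1 ≠ 0 := sub_ne_zero.2 hb1
  have hb' : b + 1 ≠ 0 := fun h => hb2 (eq_neg_of_add_eq_zero_left h)
  have hc : c - 1 ≠ 0 := sub_ne_zero.2 hc1
  have hc' : c + 1 ≠ 0 := fun h => hc2 (eq_neg_of_add_eq_zero_left h)
  have hs' : s - 1 ≠ 0 := sub_ne_zero.2 hs
  have h1 : (a - 1) * (s + 1) / ((a + 1) * (s - 1)) - 1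
      = 2 * (a - s) / ((a + 1) * (s - 1)) := by
    field_simp
    ring
  have h2 : (a - 1) * (s + 1) / ((a + 1) * (s - 1)) - α^2
      = 2 * (a - 1) * (s + a) / ((a + 1)^2 * (s - 1)) := by
    rw [hα]
    field_simp
    ring
  have h3 : (a - 1) * (s + 1) / ((a + 1) * (s - 1)) - β^2
      = 2 * (a - 1) * (b - s) / ((a + 1) * (s - 1) * (b - 1)) := by
    rw [hβ]
    field_simp
    ring
  have h4 : (a - 1) * (s + 1) / ((a + 1) * (s - 1)) - γ^2
      = 2 * (a - 1) * (c - s) / ((a + 1) * (s - 1) * (c - 1)) := by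
    rw [hγ]
    field_simp
    ring
  have h5 : (a - 1) * (s + 1) / ((a + 1) * (s - 1)) - α^2 / β^2
      = 2 * (a - 1) * (b + s) / ((a + 1) * (s - 1) * (b + 1)) := by
    rw [hα, hβ]
    field_simp
    ring
  have h6 : (a - 1) * (s + 1) / ((a + 1) * (s - 1)) - α^2 / γ^2
      = 2 * (a - 1) * (c + s) / ((a + 1) * (s - 1) * (c + 1)) := by
    rw [hα, hγ]
    field_simp
    ring
  have hlhs : (8 * (a - 1)^3 * t / ((a + 1)^4 * d * (s - 1)^4))^2
      = 64 * (a - 1)^6 * ((s - 1) * (s + 1) * (s^2 - a^2) * (s^2 - b^2) * (s^2 - c^2)) /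
        ((a + 1)^8 * (-((b - 1) * (b + 1) * ((c - 1) * (c + 1)))) * (s - 1)^8) := by
    have hd' : d^2 = -((b - 1) * (b + 1) * ((c - 1) * (c + 1))) := by rw [hd]; ring
    have hH' : t^2 = (s - 1) * (s + 1) * (s^2 - a^2) * (s^2 - b^2) * (s^2 - c^2) := by
      rw [hH]; ring
    rw [← hd', ← hH', div_pow]
    congr 1 <;> ring
  rw [hlhs, h1, h2, h3, h4, h5, h6]
  field_simp
  ring
end

section
/- Suppose y² = f(x) and x ≠ α. Then the point (s, t) = ((x+α)/(x−α), 4αk₂y/(x−α)⁴) satisfies t² = (s²−1)(s²−a²)(s²−b²)(s²−c²); that is, the map ζ̃(x,y) = ((x+α)/(x−α), 4αk₂y/(x−α)⁴) sends every point of V with x ≠ α to a point of the genus-3 curve H. -/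
open Complex

/-- The difference of squared Möbius images of `x` and `c` under `z ↦ (z + α) / (z - α)`. -/
theorem mobius_sq_sub_sq {α c x : ℂ} (hc : c ≠ 0) (hcα : c - α ≠ 0) (hx : x - α ≠ 0) :
    ((x + α) / (x - α))^2 - ((c + α) / (c - α))^2 =
      -4 * α * c * ((x - c) * (x - α^2 / c)) / ((x - α)^2 * (c - α)^2) := by
  field_simp
  ring

theorem zetaTilde_maps_V_to_H
    (α β γ k₂ x y : ℂ)
    (hβγ : β * γ ≠ 0)
    (hden : (1 - α) * (β^2 - α) * (γ^2 - α) ≠ 0)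
    (hk₂ : k₂^2 = -16 * α^2 * β^2 * γ^2 / ((1 - α)^2 * (β^2 - α)^2 * (γ^2 - α)^2))
    (hV : y^2 = x * (x - 1) * (x - α^2) * (x - β^2) * (x - γ^2) *
        (x - α^2 / β^2) * (x - α^2 / γ^2))
    (hx : x ≠ α) :
    (4 * α * k₂ * y / (x - α)^4)^2 =
      (((x + α) / (x - α))^2 - 1) *
      (((x + α) / (x - α))^2 - ((1 + α) / (1 - α))^2) *
      (((x + α) / (x - α))^2 - ((β^2 + α) / (β^2 - α))^2) *
      (((x + α) / (x - α))^2 - ((γ^2 + α) / (γ^2 - α))^2) := by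
  have hxα : x - α ≠ 0 := sub_ne_zero.mpr hx
  obtain ⟨hβ, hγ⟩ := mul_ne_zero_iff.mp hβγ
  obtain ⟨h12, h3⟩ := mul_ne_zero_iff.mp hden
  obtain ⟨h1, h2⟩ := mul_ne_zero_iff.mp h12
  have hs : ((x + α) / (x - α))^2 - 1 = 4 * α * x / (x - α)^2 := by
    field_simp
    ring
  rw [hs, mobius_sq_sub_sq one_ne_zero h1 hxα, mobius_sq_sub_sq (pow_ne_zero 2 hβ) h2 hxα,
    mobius_sq_sub_sq (pow_ne_zero 2 hγ) h3 hxα, div_pow, mul_pow, mul_pow, hk₂, hV]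
  generalize α^2 / β^2 = u, α^2 / γ^2 = v, x - α = d, 1 - α = p, β^2 - α = q, γ^2 - α = r
    at h1 h2 h3 hxα ⊢
  field_simp
  ring
end

section
/- Suppose T² = (S−1)(S−a²)(S−b²)(S−c²), S ≠ 1, and k₂ ≠ 0. Then the point (X, Y) = (k₁²((α+1)² − (α−1)²S)/(S−1), 4αk₁³T/(k₂(S−1)²)) satisfies Y² = X(X−1)(X − k₁²(1 − 1/γ²)(γ² − α²)); that is, the map ξ sends every point of W with S ≠ 1 to a point of the elliptic curve E. -/
open Complex

theorem xi_maps_W_to_E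
    (α β γ k₁ k₂ S T : ℂ)
    (hβγ : β * γ ≠ 0)
    (hβα : (1 - β^2) * (β^2 - α^2) ≠ 0)
    (hden : (1 - α) * (β^2 - α) * (γ^2 - α) ≠ 0)
    (hk₁ : k₁^2 = -β^2 / ((1 - β^2) * (β^2 - α^2)))
    (hk₂ : k₂^2 = -16 * α^2 * β^2 * γ^2 / ((1 - α)^2 * (β^2 - α)^2 * (γ^2 - α)^2))
    (hW : T^2 = (S - 1) * (S - ((1 + α) / (1 - α))^2) * (S - ((β^2 + α) / (β^2 - α))^2) *
        (S - ((γ^2 + α) / (γ^2 - α))^2))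
    (hS : S ≠ 1)
    (hk₂0 : k₂ ≠ 0) :
    (4 * α * k₁^3 * T / (k₂ * (S - 1)^2))^2 =
      (k₁^2 * ((α + 1)^2 - (α - 1)^2 * S) / (S - 1)) *
      (k₁^2 * ((α + 1)^2 - (α - 1)^2 * S) / (S - 1) - 1) *
      (k₁^2 * ((α + 1)^2 - (α - 1)^2 * S) / (S - 1) - k₁^2 * (1 - 1 / γ^2) * (γ^2 - α^2)) := by
  obtain ⟨hβ, hγ⟩ := mul_ne_zero_iff.mp hβγ
  obtain ⟨hd, hc⟩ := mul_ne_zero_iff.mp hden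
  obtain ⟨ha, hb⟩ := mul_ne_zero_iff.mp hd
  obtain ⟨hβ1, hβα'⟩ := mul_ne_zero_iff.mp hβα
  have hS1 : S - 1 ≠ 0 := sub_ne_zero.mpr hS
  have hα : α ≠ 0 := by
    rintro rfl
    exact hk₂0 (by simpa using hk₂)
  have hone : k₁^2 * (-((1 - β^2) * (β^2 - α^2)) / β^2) = 1 := by
    rw [hk₁]
    field_simp
  have hX : k₁^2 * ((α + 1)^2 - (α - 1)^2 * S) / (S - 1) =
      -k₁^2 * (1 - α)^2 * (S - ((1 + α) / (1 - α))^2) / (S - 1) := by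
    field_simp
    ring
  have hX1 : k₁^2 * ((α + 1)^2 - (α - 1)^2 * S) / (S - 1) - 1 =
      -k₁^2 * (β^2 - α)^2 * (S - ((β^2 + α) / (β^2 - α))^2) / (β^2 * (S - 1)) := by
    refine (congrArg (_ - ·) hone.symm).trans ?_
    field_simp
    ring
  have hXc : k₁^2 * ((α + 1)^2 - (α - 1)^2 * S) / (S - 1) -
        k₁^2 * (1 - 1 / γ^2) * (γ^2 - α^2) =
      -k₁^2 * (γ^2 - α)^2 * (S - ((γ^2 + α) / (γ^2 - α))^2) / (γ^2 * (S - 1)) := by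
    field_simp
    ring
  rw [hX1, hXc, hX, div_pow, mul_pow _ T, mul_pow k₂, hW, hk₂]
  generalize S - ((1 + α) / (1 - α))^2 = A
  generalize S - ((β^2 + α) / (β^2 - α))^2 = B
  generalize S - ((γ^2 + α) / (γ^2 - α))^2 = C
  field_simp
  ring
end

section
/- Let α, k₁, k₂ ∈ ℂ with α ≠ 0 and k₂ ≠ 0, and let x, y ∈ ℂ with x ≠ 0 and x ≠ α. Set s = (x+α)/(x−α), t = 4αk₂y/(x−α)⁴, S = s², T = t. Then S ≠ 1, and k₁²((α+1)² − (α−1)²S)/(S−1) = k₁²(x−1)(x−α²)/x and 4αk₁³T/(k₂(S−1)²) = k₁³y/x². That is, the composite ξ ∘ φ₁^H ∘ ζ̃, where φ₁^H(s,t) = (s², t), equals the map φ₁(x,y) = (k₁²(x−1)(x−α²)/x, k₁³y/x²). -/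
open Complex

theorem xi_phiH_zetaTilde_eq_phi1
    (α k₁ k₂ x y : ℂ)
    (hα : α ≠ 0) (hk₂ : k₂ ≠ 0)
    (hx0 : x ≠ 0) (hxα : x ≠ α) :
    ((x + α) / (x - α))^2 ≠ 1 ∧
    k₁^2 * ((α + 1)^2 - (α - 1)^2 * (((x + α) / (x - α))^2)) /
        ((((x + α) / (x - α))^2) - 1) = k₁^2 * (x - 1) * (x - α^2) / x ∧
    4 * α * k₁^3 * (4 * α * k₂ * y / (x - α)^4) /
        (k₂ * ((((x + α) / (x - α))^2) - 1)^2) = k₁^3 * y / x^2 := by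
  have hd : x - α ≠ 0 := sub_ne_zero.mpr hxα
  have hS : ((x + α) / (x - α))^2 - 1 = 4 * α * x / (x - α)^2 := by
    field_simp
    ring
  have hN : (α + 1)^2 - (α - 1)^2 * ((x + α) / (x - α))^2 =
      4 * α * (x - 1) * (x - α^2) / (x - α)^2 := by
    field_simp
    ring
  refine ⟨?_, ?_, ?_⟩
  · rw [← sub_ne_zero, hS]
    simp [hα, hx0, hd]
  · rw [hS, hN]
    field_simp
  · rw [hS]
    field_simp
end

section
/- For all x ∈ ℂ with x ≠ 0, one has f(α²/x) = α⁸ f(x)/x⁸. Consequently, if y² = f(x) and x ≠ 0, then the point (α²/x, α⁴y/x⁴) also satisfies the equation of V, i.e. (α⁴y/x⁴)² = f(α²/x); so ι(x,y) = (α²/x, α⁴y/x⁴) is an involution of the affine curve V away from x = 0. -/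
open Complex

theorem involution_of_V
    (α β γ : ℂ) (hβγ : β * γ ≠ 0) :
    (∀ x : ℂ, x ≠ 0 →
      (α^2 / x) * (α^2 / x - 1) * (α^2 / x - α^2) * (α^2 / x - β^2) * (α^2 / x - γ^2) *
          (α^2 / x - α^2 / β^2) * (α^2 / x - α^2 / γ^2) =
        α^8 * (x * (x - 1) * (x - α^2) * (x - β^2) * (x - γ^2) *
          (x - α^2 / β^2) * (x - α^2 / γ^2)) / x^8) ∧
    (∀ x y : ℂ, x ≠ 0 →
      y^2 = x * (x - 1) * (x - α^2) * (x - β^2) * (x - γ^2) *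
          (x - α^2 / β^2) * (x - α^2 / γ^2) →
      (α^4 * y / x^4)^2 =
        (α^2 / x) * (α^2 / x - 1) * (α^2 / x - α^2) * (α^2 / x - β^2) * (α^2 / x - γ^2) *
          (α^2 / x - α^2 / β^2) * (α^2 / x - α^2 / γ^2)) := by
  obtain ⟨hβ, hγ⟩ := mul_ne_zero_iff.mp hβγ
  have key : ∀ x : ℂ, x ≠ 0 →
      (α^2 / x) * (α^2 / x - 1) * (α^2 / x - α^2) * (α^2 / x - β^2) * (α^2 / x - γ^2) *
          (α^2 / x - α^2 / β^2) * (α^2 / x - α^2 / γ^2) =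
        α^8 * (x * (x - 1) * (x - α^2) * (x - β^2) * (x - γ^2) *
          (x - α^2 / β^2) * (x - α^2 / γ^2)) / x^8 := by
    intro x hx
    field_simp
    ring
  refine ⟨key, fun x y hx hy => ?_⟩
  rw [key x hx, ← hy]
  ring
end

section
/- Let α, k₁ ∈ ℂ with k₁ ≠ 0, and let x, y, x', y' ∈ ℂ with x ≠ 0 and x' ≠ 0. If k₁²(x'−1)(x'−α²)/x' = k₁²(x−1)(x−α²)/x and k₁³y'/x'² = k₁³y/x², then either (x', y') = (x, y) or (x', y') = (α²/x, α⁴y/x⁴). That is, the map φ₁(x,y) = (k₁²(x−1)(x−α²)/x, k₁³y/x²) has degree 2: each of its fibers consists of at most the two points (x,y) and (α²/x, α⁴y/x⁴). -/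
open Complex

theorem phi1_fibers
    (α k₁ x y x' y' : ℂ) (hk₁ : k₁ ≠ 0) (hx : x ≠ 0) (hx' : x' ≠ 0)
    (h1 : k₁^2 * (x' - 1) * (x' - α^2) / x' = k₁^2 * (x - 1) * (x - α^2) / x)
    (h2 : k₁^3 * y' / x'^2 = k₁^3 * y / x^2) :
    (x', y') = (x, y) ∨ (x', y') = (α^2 / x, α^4 * y / x^4) := by
  have hy : y' = y * x'^2 / x^2 := by
    rw [div_eq_div_iff (pow_ne_zero 2 hx') (pow_ne_zero 2 hx)] at h2
    rw [eq_div_iff (pow_ne_zero 2 hx)]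
    exact mul_left_cancel₀ (pow_ne_zero 3 hk₁) (by linear_combination h2)
  have hfactor : (x' - x) * (x' * x - α^2) = 0 := by
    rw [div_eq_div_iff hx' hx] at h1
    exact mul_left_cancel₀ (pow_ne_zero 2 hk₁) (by linear_combination h1)
  rcases mul_eq_zero.mp hfactor with h | h
  · left
    obtain rfl : x' = x := sub_eq_zero.mp h
    rw [hy, mul_div_cancel_right₀ _ (pow_ne_zero 2 hx)]
  · right
    have hx'_eq : x' = α^2 / x := by
      rw [eq_div_iff hx]
      exact sub_eq_zero.mp h
    rw [hy, hx'_eq, Prod.mk.injEq]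
    refine ⟨rfl, ?_⟩
    field_simp
end

section
/- Let α, k₁ ∈ ℂ with k₁ ≠ 0, and let x ∈ ℂ with x ≠ 0. (i) The function g : ℂ → ℂ, g(x) = k₁²(x−1)(x−α²)/x, has derivative g'(x) = k₁²(x²−α²)/x² at x. (ii) If moreover y ∈ ℂ with y ≠ 0 and Y = k₁³y/x², then −g'(x)/(2Y) = (1/k₁)·(−x²/(2y)) + (−α²/k₁)·(−1/(2y)). (This identity says that the pullback under φ₁ of the holomorphic differential ω_E = −dX/(2Y) on E equals (1/k₁)ω₁^V − (α²/k₁)ω₅^V, which is the content of Lemma 4.1: K₁ = (1/k₁)(1, 0, −α²).) -/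
open Complex

theorem phi1_pullback_differential
    (α k₁ x : ℂ) (hk₁ : k₁ ≠ 0) (hx : x ≠ 0) :
    HasDerivAt (fun z : ℂ => k₁^2 * (z - 1) * (z - α^2) / z)
      (k₁^2 * (x^2 - α^2) / x^2) x ∧
    ∀ y : ℂ, y ≠ 0 →
      -(k₁^2 * (x^2 - α^2) / x^2) / (2 * (k₁^3 * y / x^2)) =
        (1 / k₁) * (-(x^2) / (2 * y)) + (-α^2 / k₁) * (-1 / (2 * y)) := by
  refine ⟨?_, fun y hy => ?_⟩
  · have h := ((((hasDerivAt_id x).sub_const 1).const_mul (k₁ ^ 2)).mul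
      ((hasDerivAt_id x).sub_const (α ^ 2))).div (hasDerivAt_id x) hx
    refine h.congr_deriv ?_
    simp only [id, Pi.mul_apply]
    field_simp
    ring
  · field_simp
    ring
end

section
/- Let α, k₂ ∈ ℂ with k₂ ≠ 0, and let x ∈ ℂ with x ≠ α. (i) The function h : ℂ → ℂ, h(x) = ((x+α)/(x−α))², has derivative h'(x) = −4α(x+α)/(x−α)³ at x. (ii) If moreover y ∈ ℂ with y ≠ 0, and X = h(x), Y = 4αk₂(x+α)y/(x−α)⁵, and α ≠ 0, then −X·h'(x)/(2Y) = (−1/k₂)·(−x²/(2y)) + (−2α/k₂)·(−x/(2y)) + (−α²/k₂)·(−1/(2y)). (This identity says that the pullback under φ₂ of the differential ω₁^C = −X dX/(2Y) on C equals −(1/k₂)ω₁^V − (2α/k₂)ω₃^V − (α²/k₂)ω₅^V, giving the first row of K₂ in Lemma 4.2.) -/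
open Complex

theorem phi2_pullback_differential_first_row
    (α k₂ x : ℂ) (hk₂ : k₂ ≠ 0) (hx : x ≠ α) :
    HasDerivAt (fun z : ℂ => ((z + α) / (z - α))^2)
      (-4 * α * (x + α) / (x - α)^3) x ∧
    ∀ y : ℂ, y ≠ 0 → α ≠ 0 →
      -(((x + α) / (x - α))^2) * (-4 * α * (x + α) / (x - α)^3) /
          (2 * (4 * α * k₂ * (x + α) * y / (x - α)^5)) =
        (-1 / k₂) * (-(x^2) / (2 * y)) + (-2 * α / k₂) * (-x / (2 * y)) +
          (-α^2 / k₂) * (-1 / (2 * y)) := by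
  have hsub : x - α ≠ 0 := sub_ne_zero.mpr hx
  refine ⟨?_, fun y hy hα => ?_⟩
  · have h := (((hasDerivAt_id' x).add_const α).fun_div
      ((hasDerivAt_id' x).sub_const α) hsub).fun_pow 2
    refine h.congr_deriv ?_
    push_cast
    field_simp
    ring
  · have hrhs : (-1 / k₂) * (-(x^2) / (2 * y)) + (-2 * α / k₂) * (-x / (2 * y)) +
        (-α^2 / k₂) * (-1 / (2 * y)) = (x + α)^2 / (2 * k₂ * y) := by
      field_simp
      ring
    rw [hrhs]
    by_cases hadd : x + α = 0
    · simp [hadd]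
    · field_simp
end
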